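/- Let 𝐏 ⊂ ℤ^n be a finite set with P = Conv(𝐏), and let S be a proper face of P with 𝐒 = 𝐏 ∩ S. Then Σ_ξ Vol_ℤ(P̃_S(ξ)) = c_𝐏^𝐒, where the sum is over all linear functionals ξ on π_S(ℝ^n) whose maximizing face on π_S(P) is exactly the point O_S = π_S(S), and the lattice volume is computed in π_S(ℝ^n) with respect to the quotient lattice (only finitely many terms are nonzero). -/

import Mathlib

open Pointwise Filter
open scoped Classical

noncomputable section

def intLattice (n : ℕ) : AddSubgroup (Fin n → ℝ) where
  carrier := {x | ∀ i, ∃ m : ℤ, x i = (m : ℝ)}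
  zero_mem' := fun i => ⟨0, by simp⟩
  add_mem' := by
    intro a b ha hb i
    obtain ⟨p, hp⟩ := ha i
    obtain ⟨q, hq⟩ := hb i
    exact ⟨p + q, by simp [hp, hq]⟩
  neg_mem' := by
    intro a ha i
    obtain ⟨p, hp⟩ := ha i
    exact ⟨-p, by simp [hp]⟩

/-- Lattice volume (normalized so that a unit simplex of the lattice `L` has
volume `1`) of a `k`-dimensional set `Q`, defined via asymptotic counting of
lattice points in dilations of `Q`. -/
def latVol {E : Type*} [AddCommGroup E] [Module ℝ E] (L : AddSubgroup E)
    (k : ℕ) (Q : Set E) : ℝ :=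
  Filter.limsup
    (fun t : ℕ => (Nat.factorial k : ℝ) *
      (Nat.card ↥(((t : ℝ) • Q) ∩ (L : Set E))) / (t : ℝ) ^ k) Filter.atTop

/-- Mixed volume of the polytopes `Q i`, `i ∈ T`, via inclusion-exclusion of
lattice volumes of Minkowski sums. -/
def mixedVol {E : Type*} [AddCommGroup E] [Module ℝ E] {ι : Type*}
    (L : AddSubgroup E) (T : Finset ι) (Q : ι → Set E) : ℝ :=
  ∑ I ∈ T.powerset,
    if I.Nonempty then
      (-1 : ℝ) ^ (T.card - I.card) * latVol L T.card (∑ i ∈ I, Q i)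
    else 0

/-- `F` is a face of `P`: the set of maximizers over `P` of some linear functional. -/
def IsFaceOf {E : Type*} [AddCommGroup E] [Module ℝ E] (P F : Set E) : Prop :=
  ∃ ξ : E →ₗ[ℝ] ℝ, F = {x ∈ P | ∀ y ∈ P, ξ y ≤ ξ x}

/-- Dimension of (the affine span of) a set. -/
def sdim {E : Type*} [AddCommGroup E] [Module ℝ E] (Q : Set E) : ℕ :=
  Module.finrank ℝ (vectorSpan ℝ Q)

/-- The family D-family: faces of `P` maximal among the faces disjoint from `D`. -/
def DFam {E : Type*} [AddCommGroup E] [Module ℝ E] (P D : Set E) : Set (Set E) :=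
  {F | Maximal (fun G => IsFaceOf P G ∧ G ∩ D = ∅) F}

/-- `D` is a daughter polytope of the finite set `A`. -/
def IsDaughter {E : Type*} [AddCommGroup E] [Module ℝ E] (A : Finset E) (D : Set E) : Prop :=
  D.Nonempty ∧
  (∀ F ∈ DFam (convexHull ℝ (A : Set E)) D, ∀ F' ∈ DFam (convexHull ℝ (A : Set E)) D,
    F ≠ F' → F ∩ F' = ∅) ∧
  D = convexHull ℝ ((A : Set E) \ ⋃ F ∈ DFam (convexHull ℝ (A : Set E)) D, F)

/-- The daughter polytopes `D i`, `i ∈ T`, are semi-interlaced in `A`. -/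
def SemiInterlaced {E : Type*} [AddCommGroup E] [Module ℝ E] {ι : Type*}
    (A : Finset E) (T : Finset ι) (D : ι → Set E) : Prop :=
  (∀ i ∈ T, IsDaughter A (D i)) ∧
  ∀ F, IsFaceOf (convexHull ℝ (A : Set E)) F →
    sdim F ≤ (T.filter fun i => (D i ∩ F).Nonempty).card

/-- A face `F` of `Conv A` is a suture if exactly `dim F` of the `D i` meet it. -/
def IsSuture {E : Type*} [AddCommGroup E] [Module ℝ E] {ι : Type*}
    (A : Finset E) (T : Finset ι) (D : ι → Set E) (F : Set E) : Prop :=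
  IsFaceOf (convexHull ℝ (A : Set E)) F ∧
  (T.filter fun i => (D i ∩ F).Nonempty).card = sdim F


/-- The image of the integer lattice in the quotient of `ℝⁿ` by `W`. -/
def quotLat (n : ℕ) (W : Submodule ℝ (Fin n → ℝ)) : AddSubgroup ((Fin n → ℝ) ⧸ W) :=
  (intLattice n).map W.mkQ.toAddMonoidHom

/-- For a polyhedron `Q ⊆ E ⊕ ℝ`, the set `Q(ξ)`: the image in `E` of the face
of `Q` on which the functional `(ξ, 1)` attains its maximum. -/
def supFaceSlice {E : Type*} [AddCommGroup E] [Module ℝ E]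
    (ξ : E →ₗ[ℝ] ℝ) (Q : Set (E × ℝ)) : Set E :=
  Prod.fst '' {x ∈ Q | ∀ y ∈ Q, ξ y.1 + y.2 ≤ ξ x.1 + x.2}

/-- The polyhedron `P̃_S = Conv({(a,y) : a ∈ A_S ∖ {O}, y ≤ 0} ∪ {(O,y) : y ≤ −1})`. -/
def tildeP {E : Type*} [AddCommGroup E] [Module ℝ E] (AS : Set E) (O : E) : Set (E × ℝ) :=
  convexHull ℝ ({p : E × ℝ | p.1 ∈ AS \ {O} ∧ p.2 ≤ 0} ∪ {p : E × ℝ | p.1 = O ∧ p.2 ≤ -1})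

/-- The set `A_S = π_S(A) ∩ closure (π_S(P) ∖ π_S(Conv (A ∖ S)))` in the quotient
of `ℝⁿ` by `aff S`. -/
def projSet (n : ℕ) (A : Finset (Fin n → ℝ)) (S : Set (Fin n → ℝ)) :
    Set ((Fin n → ℝ) ⧸ vectorSpan ℝ S) :=
  ((vectorSpan ℝ S).mkQ '' (A : Set (Fin n → ℝ))) ∩
    closure (((vectorSpan ℝ S).mkQ '' convexHull ℝ (A : Set (Fin n → ℝ))) \
      ((vectorSpan ℝ S).mkQ '' convexHull ℝ ((A : Set (Fin n → ℝ)) \ S)))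

open MeasureTheory in
theorem latVol_eq_volume {k : ℕ} {E : Type*} [AddCommGroup E] [Module ℝ E] (L : AddSubgroup E)
    (e : E ≃ₗ[ℝ] (Fin k → ℝ)) (he : ∀ x, x ∈ L ↔ e x ∈ intLattice k) (D : Set E)
    (hD : D.Finite) :
    latVol L k (convexHull ℝ D) = k.factorial * volume.real (convexHull ℝ (e '' D)) := by
  have hfin : (e '' D).Finite := hD.image _
  have hc : IsCompact (convexHull ℝ (e '' D)) := Set.Finite.isCompact_convexHull (𝕜 := ℝ) hfin
  have hconv : Convex ℝ (convexHull ℝ (e '' D)) := convex_convexHull ℝ _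
  have h := tendsto_card_div_pow_atTop_volume (convexHull ℝ (e '' D)) hc.isBounded hc.measurableSet
    (hconv.addHaar_frontier volume)
  apply Tendsto.limsup_eq
  refine (h.const_mul (k.factorial : ℝ)).congr' ?_
  filter_upwards [eventually_gt_atTop 0] with t ht
  have ht' : (t : ℝ) ≠ 0 := by positivity
  rw [← mul_div_assoc, Fintype.card_fin]
  congr 3
  have himg : convexHull ℝ (e '' D) = e '' convexHull ℝ D :=
    (LinearMap.image_convexHull e.toLinearMap D).symm
  rw [himg]
  symm
  refine Nat.card_congr ((Equiv.trans e.toEquiv (Homeomorph.smulOfNeZero (t : ℝ)⁻¹ (inv_ne_zero ht')).toEquiv).subtypeEquiv fun x ↦ ?_)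
  have h1 : ∀ y : Fin k → ℝ, y ∈ (Submodule.span ℤ (Set.range (Pi.basisFun ℝ (Fin k))) : Set (Fin k → ℝ)) ↔ y ∈ intLattice k := by
    intro y
    rw [SetLike.mem_coe, Module.Basis.mem_span_iff_repr_mem]
    simp [intLattice, eq_comm]
  simp only [Set.mem_inter_iff, Equiv.trans_apply, Homeomorph.coe_toEquiv, 
    Homeomorph.smulOfNeZero_apply, LinearEquiv.coe_toEquiv]
  rw [Set.smul_mem_smul_set_iff₀ (inv_ne_zero ht'), h1, ← he, ← LinearEquiv.map_smul,
    e.injective.mem_set_image, Set.mem_smul_set_iff_inv_smul_mem₀ ht', SetLike.mem_coe]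

theorem exists_lattice_equiv {n : ℕ} {W : Submodule ℝ (Fin n → ℝ)} {k : ℕ}
    (hk : Module.finrank ℝ ((Fin n → ℝ) ⧸ W) = k) (V : Set (Fin n → ℝ)) 
    (hV : ∀ v ∈ V, v ∈ intLattice n) (hW : W = Submodule.span ℝ V) :
    ∃ e : ((Fin n → ℝ) ⧸ W) ≃ₗ[ℝ] (Fin k → ℝ), ∀ x, x ∈ quotLat n W ↔ e x ∈ intLattice k := by
  obtain ⟨e0⟩ : Nonempty (((Fin n → ℝ) ⧸ W) ≃ₗ[ℝ] (Fin k → ℝ)) :=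
    ⟨LinearEquiv.ofFinrankEq _ _ (by simp [hk])⟩
  obtain ⟨s, hs⟩ : ∃ s : ((Fin n → ℝ) ⧸ W) →ₗ[ℝ] (Fin n → ℝ), W.mkQ ∘ₗ s = LinearMap.id :=
    W.mkQ.exists_rightInverse_of_surjective W.range_mkQ
  obtain ⟨R, hR⟩ : ∃ R : ℝ, ∀ w ∈ W, ∃ z ∈ intLattice n, z ∈ W ∧ ‖w - z‖ ≤ R := by
    obtain ⟨V', hV', hsp, hli⟩ := exists_linearIndependent ℝ V
    have hfin : V'.Finite := hli.setFinite
    have := hfin.fintype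
    refine ⟨∑ v : V', ‖(v : Fin n → ℝ)‖, fun w hw => ?_⟩
    rw [hW, ← hsp, ← Subtype.range_coe (s := V'), Submodule.mem_span_range_iff_exists_fun] at hw
    obtain ⟨c, rfl⟩ := hw
    refine ⟨∑ v : V', (⌊c v⌋ : ℝ) • (v : Fin n → ℝ), ?_, ?_, ?_⟩
    · refine AddSubgroup.sum_mem _ fun v _ => ?_
      rw [Int.cast_smul_eq_zsmul]
      exact AddSubgroup.zsmul_mem _ (hV _ (hV' v.2)) _
    · refine Submodule.sum_mem _ fun v _ => Submodule.smul_mem _ _ ?_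
      rw [hW]
      exact Submodule.subset_span (hV' v.2)
    · rw [← Finset.sum_sub_distrib]
      refine (norm_sum_le _ _).trans (Finset.sum_le_sum fun v _ => ?_)
      rw [← sub_smul, norm_smul]
      refine mul_le_of_le_one_left (norm_nonneg _) ?_
      rw [Real.norm_eq_abs, abs_le]
      constructor <;> linarith [Int.floor_le (c v), Int.lt_floor_add_one (c v)]
  let L0 : Submodule ℤ (Fin k → ℝ) :=
    AddSubgroup.toIntSubmodule ((quotLat n W).map e0.toLinearMap.toAddMonoidHom)
  have hmem : ∀ y, y ∈ L0 ↔ ∃ z ∈ intLattice n, e0 (W.mkQ z) = y := by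
    intro y
    change y ∈ (quotLat n W).map e0.toLinearMap.toAddMonoidHom ↔ _
    simp only [quotLat, AddSubgroup.mem_map]
    constructor
    · rintro ⟨x, ⟨z, hz, rfl⟩, rfl⟩
      exact ⟨z, hz, rfl⟩
    · rintro ⟨z, hz, rfl⟩
      exact ⟨_, ⟨z, hz, rfl⟩, rfl⟩
  have hfinZ : ∀ r : ℝ, (Metric.closedBall (0 : Fin n → ℝ) r ∩ (intLattice n : Set (Fin n → ℝ))).Finite := by
    intro r
    have := ZSpan.setFinite_inter (Pi.basisFun ℝ (Fin n)) (s := Metric.closedBall (0 : Fin n → ℝ) r) Metric.isBounded_closedBall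
    refine this.subset ?_
    rintro x ⟨hx, hx2⟩
    refine ⟨hx, ?_⟩
    rw [SetLike.mem_coe, Module.Basis.mem_span_iff_repr_mem]
    intro i
    obtain ⟨m, hm⟩ := hx2 i
    exact ⟨m, by simp [hm]⟩
  have hfin : (Metric.ball (0 : Fin k → ℝ) 1 ∩ (L0 : Set (Fin k → ℝ))).Finite := by
    let g : (Fin k → ℝ) →L[ℝ] (Fin n → ℝ) := (s ∘ₗ e0.symm.toLinearMap).toContinuousLinearMap
    refine ((hfinZ (‖g‖ + R)).image (fun z => e0 (W.mkQ z))).subset ?_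
    rintro y ⟨hy, hyL⟩
    obtain ⟨z, hz, rfl⟩ := (hmem _).1 hyL
    have hzW : z - g (e0 (W.mkQ z)) ∈ W := by
      rw [← Submodule.Quotient.mk_eq_zero, ← Submodule.mkQ_apply, map_sub]
      have : W.mkQ (s (W.mkQ z)) = W.mkQ z := LinearMap.congr_fun hs (W.mkQ z)
      simp only [g, LinearMap.coe_toContinuousLinearMap', LinearMap.comp_apply, LinearEquiv.coe_coe,
        LinearEquiv.symm_apply_apply, this, sub_self]
    obtain ⟨z', hz', hz'W, hle⟩ := hR _ hzW
    refine ⟨z - z', ⟨?_, AddSubgroup.sub_mem _ hz hz'⟩, ?_⟩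
    · rw [mem_closedBall_zero_iff]
      have h1 : ‖g (e0 (W.mkQ z))‖ ≤ ‖g‖ := by
        refine (g.le_opNorm _).trans (mul_le_of_le_one_right (norm_nonneg _) ?_)
        exact (mem_ball_zero_iff.1 hy).le
      calc ‖z - z'‖ = ‖g (e0 (W.mkQ z)) + (z - g (e0 (W.mkQ z)) - z')‖ := by congr 1; abel
        _ ≤ _ := (norm_add_le _ _).trans (add_le_add h1 hle)
    · have : W.mkQ z' = 0 := by simpa using hz'W
      simp only [map_sub, this, sub_zero]
  have : DiscreteTopology L0 := by
    refine discreteTopology_of_isOpen_singleton_zero ?_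
    have h2 : ((fun x : L0 => (x : Fin k → ℝ)) ⁻¹' Metric.ball 0 1).Finite := by
      refine Set.Finite.of_finite_image (hfin.subset ?_) Subtype.val_injective.injOn
      rintro _ ⟨x, hx, rfl⟩
      exact ⟨hx, x.2⟩
    have h3 : IsOpen ((fun x : L0 => (x : Fin k → ℝ)) ⁻¹' Metric.ball 0 1) :=
      Metric.isOpen_ball.preimage continuous_subtype_val
    have h4 := h3.sdiff (h2.subset (Set.sdiff_subset (t := {0}))).isClosed
    convert h4 using 1
    ext x
    simp only [Set.mem_singleton_iff, Set.mem_sdiff, Set.mem_preimage]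
    constructor
    · rintro rfl; simp
    · rintro ⟨h, h'⟩; by_contra hne; exact h' ⟨h, hne⟩
  have : IsZLattice ℝ L0 := by
    constructor
    rw [eq_top_iff]
    rintro y -
    obtain ⟨x, rfl⟩ := e0.surjective y
    obtain ⟨z, rfl⟩ := W.mkQ_surjective x
    have : z = ∑ i, z i • (Pi.single i 1 : Fin n → ℝ) := by
      ext j; simp [Finset.sum_apply, Pi.single_apply]
    rw [this, map_sum, map_sum]
    refine Submodule.sum_mem _ fun i _ => ?_
    rw [map_smul, map_smul]
    refine Submodule.smul_mem _ _ (Submodule.subset_span ((hmem _).2 ⟨_, ?_, rfl⟩))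
    intro j
    by_cases h : j = i
    · subst h; exact ⟨1, by simp⟩
    · exact ⟨0, by simp [h]⟩
  have := ZLattice.module_free ℝ L0
  have := ZLattice.module_finite ℝ L0
  have hrk : Module.finrank ℤ L0 = k := by rw [ZLattice.rank ℝ L0]; simp
  let b := Module.finBasisOfFinrankEq ℤ L0 hrk
  refine ⟨e0.trans (b.ofZLatticeBasis ℝ L0).equivFun, fun x => ?_⟩
  have h1 : x ∈ quotLat n W ↔ e0 x ∈ L0 := by
    rw [hmem]
    constructor
    · rintro ⟨z, hz, rfl⟩; exact ⟨z, hz, rfl⟩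
    · rintro ⟨z, hz, h⟩; exact ⟨z, hz, e0.injective h⟩
  have h2 : e0 x ∈ L0 ↔ e0 x ∈ Submodule.span ℤ (Set.range (b.ofZLatticeBasis ℝ L0)) := by
    rw [b.ofZLatticeBasis_span ℝ L0]
  rw [h1, h2, Module.Basis.mem_span_iff_repr_mem]
  simp [intLattice, eq_comm]

theorem linfun_le_on_hull {E : Type*} [AddCommGroup E] [Module ℝ E] (f : E →ₗ[ℝ] ℝ) (c : ℝ)
    (D : Set E) (h : ∀ d ∈ D, f d ≤ c) : ∀ x ∈ convexHull ℝ D, f x ≤ c := by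
  intro x hx
  exact convexHull_min (t := {x | f x ≤ c}) h (convex_halfSpace_le f.isLinear c) hx

/-- maximizing face of a convex hull -/
theorem face_hull {E : Type*} [AddCommGroup E] [Module ℝ E] (f : E →ₗ[ℝ] ℝ) (c : ℝ)
    (G : Set E) (h : ∀ d ∈ G, f d ≤ c) :
    {x ∈ convexHull ℝ G | f x = c} = convexHull ℝ {x ∈ G | f x = c} := by
  apply Set.Subset.antisymm
  · have hK : Convex ℝ ({x | f x < c} ∪ convexHull ℝ {x ∈ G | f x = c}) := by
      have h2 : ∀ x ∈ convexHull ℝ {x ∈ G | f x = c}, f x ≤ c :=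
        linfun_le_on_hull f c _ fun d hd => hd.2.le
      rw [convex_iff_forall_pos]
      intro x hx y hy a b ha hb hab
      have hfe : f (a • x + b • y) = a * f x + b * f y := by simp
      have hc : c = a * c + b * c := by rw [← add_mul, hab, one_mul]
      rcases hx with hx | hx
      · have hy' : f y ≤ c := by
          rcases hy with hy | hy
          · exact le_of_lt hy
          · exact h2 y hy
        left
        change f _ < c
        rw [hfe, hc]
        exact add_lt_add_of_lt_of_le (mul_lt_mul_of_pos_left hx ha)
          (mul_le_mul_of_nonneg_left hy' hb.le)
      · rcases hy with hy | hy
        · left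
          change f _ < c
          rw [hfe, hc]
          exact add_lt_add_of_le_of_lt (mul_le_mul_of_nonneg_left (h2 x hx) ha.le)
            (mul_lt_mul_of_pos_left hy hb)
        · right
          exact convex_convexHull ℝ _ hx hy ha.le hb.le hab
    rintro x ⟨hx, hxc⟩
    have := convexHull_min (fun g hg => ?_) hK hx
    · rcases this with h1 | h1
      · exact absurd hxc (ne_of_lt h1)
      · exact h1
    · rcases (h g hg).lt_or_eq with h1 | h1
      · exact Or.inl h1
      · exact Or.inr (subset_convexHull ℝ _ ⟨hg, h1⟩)
  · intro x hx
    refine ⟨convexHull_mono (fun y hy => hy.1) hx, ?_⟩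
    apply le_antisymm
    · exact linfun_le_on_hull f c _ (fun d hd => hd.2.le) x hx
    · have := linfun_le_on_hull (-f) (-c) _ (fun d hd => by simp [hd.2]) x hx
      simpa using this

section LP

variable {ι E : Type*} [Fintype ι] [AddCommGroup E] [Module ℝ E]

/-- `w` is a weight vector representing `v` with maximal total weight. -/
def IsMaxWt (u : ι → E) (v : E) (w : ι → ℝ) : Prop :=
  (∀ i, 0 ≤ w i) ∧ ∑ i, w i • u i = v ∧
    ∀ w' : ι → ℝ, (∀ i, 0 ≤ w' i) → ∑ i, w' i • u i = v → ∑ i, w' i ≤ ∑ i, w i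

theorem exists_isMaxWt (u : ι → E) (η : E →ₗ[ℝ] ℝ) (hη : ∀ i, 1 ≤ η (u i)) (v : E)
    (w0 : ι → ℝ) (h0 : ∀ i, 0 ≤ w0 i) (hv : ∑ i, w0 i • u i = v) :
    ∃ w, IsMaxWt u v w := by
  let Φ : (ι → ℝ) →ₗ[ℝ] E := Fintype.linearCombination ℝ u
  have hΦ : ∀ w, Φ w = ∑ i, w i • u i := fun w => Fintype.linearCombination_apply ℝ u w
  let F : Set (ι → ℝ) := {w | (∀ i, 0 ≤ w i) ∧ Φ w = v}
  have hbd : ∀ w ∈ F, ∑ i, w i ≤ η v := by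
    rintro w ⟨hw, hwv⟩
    rw [← hwv, hΦ, map_sum]
    refine Finset.sum_le_sum fun i _ => ?_
    rw [map_smul, smul_eq_mul]
    exact le_mul_of_one_le_right (hw i) (hη i)
  have hFc : IsCompact F := by
    have hcl : IsClosed F := by
      have h1 : F = {w | ∀ i, 0 ≤ w i} ∩ (fun w => w - w0) ⁻¹' (LinearMap.ker Φ : Set (ι → ℝ)) := by
        ext w
        simp only [F, Set.mem_ofPred_eq, Set.mem_inter_iff, Set.mem_preimage, SetLike.mem_coe,
          LinearMap.mem_ker, map_sub, sub_eq_zero]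
        rw [hΦ w0, hv]
      rw [h1]
      refine IsClosed.inter ?_ ((LinearMap.ker Φ).closed_of_finiteDimensional.preimage (by fun_prop))
      simp only [Set.ofPred_forall]
      exact isClosed_iInter fun i => isClosed_le continuous_const (continuous_apply i)
    refine (isCompact_Icc (a := (0 : ι → ℝ)) (b := fun _ => η v)).of_isClosed_subset hcl ?_
    intro w hw
    refine ⟨fun i => hw.1 i, fun i => ?_⟩
    exact (Finset.single_le_sum (fun j _ => hw.1 j) (Finset.mem_univ i)).trans (hbd w hw)
  obtain ⟨w, hw, hmax⟩ := hFc.exists_isMaxOn (f := fun w : ι → ℝ => ∑ i, w i)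
    ⟨w0, h0, by rw [hΦ, hv]⟩ (by fun_prop)
  refine ⟨w, hw.1, by rw [← hΦ]; exact hw.2, fun w' h1 h2 => hmax (show w' ∈ F from ⟨h1, ?_⟩)⟩
  rw [hΦ, h2]

theorem IsMaxWt.dir {u : ι → E} {v : E} {w : ι → ℝ} (h : IsMaxWt u v w) (d : ι → ℝ)
    (hd : ∑ i, d i • u i = 0) (hpos : ∀ i, w i = 0 → 0 ≤ d i) : ∑ i, d i ≤ 0 := by
  have hev : ∀ᶠ ε : ℝ in nhdsWithin 0 (Set.Ioi 0), ∀ i, 0 ≤ w i + ε * d i := by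
    rw [eventually_all]
    intro i
    by_cases hi : w i = 0
    · filter_upwards [self_mem_nhdsWithin] with ε hε
      rw [hi, zero_add]
      exact mul_nonneg (le_of_lt hε) (hpos i hi)
    · have hwi : 0 < w i := lt_of_le_of_ne (h.1 i) (Ne.symm hi)
      have hc : Continuous fun ε : ℝ => w i + ε * d i := by fun_prop
      have : ∀ᶠ ε : ℝ in nhds 0, 0 < w i + ε * d i :=
        hc.continuousAt.eventually_const_lt (by simpa using hwi)
      filter_upwards [nhdsWithin_le_nhds this] with ε hε using hε.le
  obtain ⟨ε, hε, hεpos⟩ := (hev.and self_mem_nhdsWithin).exists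
  have hεpos' : (0 : ℝ) < ε := hεpos
  have := h.2.2 (fun i => w i + ε * d i) hε (by
    simp only [add_smul, Finset.sum_add_distrib, mul_smul, ← Finset.smul_sum, hd, h.2.1,
      smul_zero, add_zero])
  rw [Finset.sum_add_distrib, ← Finset.mul_sum] at this
  by_contra hcon
  push Not at hcon
  nlinarith [mul_pos hεpos' hcon]

theorem IsMaxWt.dual {u : ι → E} {v : E} {w : ι → ℝ} (h : IsMaxWt u v w)
    (hsp : Submodule.span ℝ (u '' {i | w i ≠ 0}) = ⊤) :
    ∃ η : E →ₗ[ℝ] ℝ, (∀ i, 1 ≤ η (u i)) ∧ ∀ i, w i ≠ 0 → η (u i) = 1 := by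
  let Φ : (ι → ℝ) →ₗ[ℝ] E := Fintype.linearCombination ℝ u
  have hΦ : ∀ w, Φ w = ∑ i, w i • u i := fun w => Fintype.linearCombination_apply ℝ u w
  let σ : (ι → ℝ) →ₗ[ℝ] ℝ := Fintype.linearCombination ℝ (fun _ => (1 : ℝ))
  have hσ : ∀ w, σ w = ∑ i, w i := fun w => by simp [σ, Fintype.linearCombination_apply]
  let p : Submodule ℝ (ι → ℝ) :=
    { carrier := {d | ∀ i, w i = 0 → d i = 0}
      zero_mem' := fun i _ => rfl
      add_mem' := fun {a b} ha hb i hi => by simp [ha i hi, hb i hi]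
      smul_mem' := fun c a ha i hi => by simp [ha i hi] }
  have hsurj : ∀ x, ∃ α ∈ p, Φ α = x := by
    intro x
    have : x ∈ Submodule.span ℝ (u '' {i | w i ≠ 0}) := by rw [hsp]; trivial
    have hle : Submodule.span ℝ (u '' {i | w i ≠ 0}) ≤ p.map Φ := by
      rw [Submodule.span_le]
      rintro _ ⟨i, hi, rfl⟩
      refine ⟨Pi.single i 1, ?_, ?_⟩
      · intro j hj
        have : j ≠ i := fun hji => hi (hji ▸ hj)
        simp [this]
      · simp [Φ]
    exact hle this
  have hker : σ.domRestrict p ∈ (LinearMap.ker (Φ.domRestrict p)).dualAnnihilator := by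
    rw [Submodule.mem_dualAnnihilator]
    rintro ⟨d, hdp⟩ hd
    have hd' : ∑ i, d i • u i = 0 := by rw [← hΦ]; exact hd
    have h1 := h.dir d hd' fun i hi => (hdp i hi).ge
    have h2 := h.dir (-d) (by simp [hd']) fun i hi => by simp [hdp i hi]
    simp only [Pi.neg_apply, Finset.sum_neg_distrib] at h2
    change σ d = 0
    rw [hσ]; linarith
  rw [← LinearMap.range_dualMap_eq_dualAnnihilator_ker] at hker
  obtain ⟨η, hη⟩ := hker
  have hη' : ∀ α ∈ p, η (Φ α) = ∑ i, α i := by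
    intro α hα
    have := LinearMap.congr_fun hη ⟨α, hα⟩
    rw [← hσ]
    exact this
  refine ⟨η, fun i => ?_, fun i hi => ?_⟩
  · obtain ⟨α, hα, hαu⟩ := hsurj (u i)
    have h1 := h.dir (Pi.single i 1 - α) (by
      have : Φ (Pi.single i 1 - α) = 0 := by rw [map_sub, hαu]; simp [Φ]
      rw [← hΦ, this]) (fun j hj => by
        rw [Pi.sub_apply, hα j hj, sub_zero]
        by_cases hji : j = i
        · subst hji; simp
        · simp [hji])
    rw [← hαu, hη' α hα]
    have h2 : ∑ j, (Pi.single i (1:ℝ) - α : ι → ℝ) j = 1 - ∑ j, α j := by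
      simp [Finset.sum_sub_distrib]
    linarith
  · have h1 : (Pi.single i 1 : ι → ℝ) ∈ p := by
      intro j hj
      have : j ≠ i := fun hji => hi (hji ▸ hj)
      simp [this]
    have := hη' _ h1
    simpa [Φ] using this

end LP

section Geo

variable {E : Type*} [AddCommGroup E] [Module ℝ E]

theorem wt_mem {ι : Type*} [Fintype ι] (Z : Set E) (hZ : Convex ℝ Z) (O : E) (hO : O ∈ Z)
    (p : ι → E) (w : ι → ℝ) (hw : ∀ i, 0 ≤ w i) (hp : ∀ i, w i ≠ 0 → p i ∈ Z)
    (hs : ∑ i, w i ≤ 1) (x : E) (hx : ∑ i, w i • (p i - O) = x - O) : x ∈ Z := by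
  have h := hZ.sum_mem (t := (Finset.univ : Finset (Option ι)))
    (w := fun o => o.elim (1 - ∑ i, w i) w)
    (z := fun o => o.elim O (fun i => if w i = 0 then O else p i)) ?_ ?_ ?_
  · convert h
    rw [Fintype.sum_option]
    simp only [Option.elim]
    have h1 : ∀ i, w i • (if w i = 0 then O else p i) = w i • (p i - O) + w i • O := by
      intro i
      split_ifs with hi
      · simp [hi]
      · rw [← smul_add, sub_add_cancel]
    simp only [h1, Finset.sum_add_distrib, hx, ← Finset.sum_smul, sub_smul, one_smul]
    abel
  · rintro (_ | i) -
    · simpa using hs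
    · exact hw i
  · rw [Fintype.sum_option]; simp
  · rintro (_ | i) -
    · exact hO
    · simp only [Option.elim]
      split_ifs with hi
      · exact hO
      · exact hp i hi

theorem base_mem (D : Finset E) (O : E) (w : D → ℝ) (hw : ∀ i, 0 ≤ w i) (hs : ∑ i, w i = 1)
    (x : E) (hx : ∑ i : D, w i • ((i : E) - O) = x - O) : x ∈ convexHull ℝ (D : Set E) := by
  have h := (convex_convexHull ℝ (D : Set E)).sum_mem (t := Finset.univ) (w := w)
    (z := fun i : D => (i : E)) (fun i _ => hw i) hs (fun i _ => subset_convexHull ℝ _ i.2)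
  convert h
  simp only [smul_sub, Finset.sum_sub_distrib, ← Finset.sum_smul, hs, one_smul] at hx
  exact (sub_left_injective hx).symm

theorem base_wt (D : Finset E) (O x : E) (hx : x ∈ convexHull ℝ (D : Set E)) :
    ∃ w : D → ℝ, (∀ i, 0 ≤ w i) ∧ ∑ i, w i = 1 ∧ ∑ i : D, w i • ((i : E) - O) = x - O := by
  rw [Finset.mem_convexHull'] at hx
  obtain ⟨w, h0, h1, h2⟩ := hx
  have h1' : ∑ i : D, w i = 1 := by rw [← h1]; exact Finset.sum_coe_sort D w
  have h2' : ∑ i : D, w i • (i : E) = x := by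
    rw [← h2]; exact Finset.sum_coe_sort D (fun y => w y • y)
  refine ⟨fun i => w i, fun i => h0 _ i.2, h1', ?_⟩
  simp only [smul_sub, Finset.sum_sub_distrib, ← Finset.sum_smul, h1', h2', one_smul]

theorem pyr_wt (D : Finset E) (O x : E) (hx : x ∈ convexHull ℝ (insert O (D : Set E))) :
    ∃ w : D → ℝ, (∀ i, 0 ≤ w i) ∧ ∑ i, w i ≤ 1 ∧ ∑ i : D, w i • ((i : E) - O) = x - O := by
  have hK : Convex ℝ {x : E | ∃ w : D → ℝ, (∀ i, 0 ≤ w i) ∧ ∑ i, w i ≤ 1 ∧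
      ∑ i : D, w i • ((i : E) - O) = x - O} := by
    rintro x ⟨w, hw, hs, hx⟩ y ⟨w', hw', hs', hy⟩ a b ha hb hab
    refine ⟨fun i => a * w i + b * w' i, fun i => ?_, ?_, ?_⟩
    · exact add_nonneg (mul_nonneg ha (hw i)) (mul_nonneg hb (hw' i))
    · rw [Finset.sum_add_distrib, ← Finset.mul_sum, ← Finset.mul_sum]
      nlinarith
    · simp only [add_smul, mul_smul, Finset.sum_add_distrib, ← Finset.smul_sum, hx, hy]
      have : O = a • O + b • O := by rw [← add_smul, hab, one_smul]
      nth_rw 3 [this]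
      simp only [smul_sub]; abel
  refine convexHull_min ?_ hK hx
  rintro y (rfl | hy)
  · exact ⟨0, by simp, by simp, by simp⟩
  · refine ⟨Pi.single ⟨y, hy⟩ 1, ?_, ?_, ?_⟩
    · intro i
      by_cases h : i = ⟨y, hy⟩
      · subst h; simp
      · simp [h]
    · simp
    · rw [Finset.sum_eq_single ⟨y, hy⟩]
      · simp
      · intro b _ hb; simp [hb]
      · simp

/-- `b` is visible from `O` -/
def Vis (D : Finset E) (O b : E) : Prop :=
  ∀ t : ℝ, 0 ≤ t → t < 1 → O + t • (b - O) ∉ convexHull ℝ (D : Set E)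

theorem vis_of_tight (D : Finset E) (O : E) (ξ : E →ₗ[ℝ] ℝ) (hξ : ∀ b ∈ D, ξ b ≤ ξ O - 1)
    (b : E) (hb : ξ b = ξ O - 1) : Vis D O b := by
  intro t ht0 ht1 hmem
  have := linfun_le_on_hull ξ _ _ hξ _ hmem
  simp only [map_add, map_smul, map_sub, smul_eq_mul, hb] at this
  linarith

theorem bound_of_vis (D : Finset E) (O : E) (η : E →ₗ[ℝ] ℝ) (hη : ∀ b ∈ D, 1 ≤ η (b - O))
    (ξ : E →ₗ[ℝ] ℝ) (hξ : ∀ b ∈ D, Vis D O b → ξ b ≤ ξ O - 1) : ∀ b ∈ D, ξ b ≤ ξ O - 1 := by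
  intro b hb
  have hsingle : ∑ i : D, (Pi.single (⟨b, hb⟩ : D) (1 : ℝ) : D → ℝ) i • ((i : E) - O) = b - O := by
    rw [Finset.sum_eq_single ⟨b, hb⟩]
    · simp
    · intro c _ hc; simp [hc]
    · simp
  have hsn : ∀ (j i : D), 0 ≤ (Pi.single j (1 : ℝ) : D → ℝ) i := by
    intro j i
    by_cases h : i = j
    · subst h; simp
    · simp [h]
  obtain ⟨w, hw⟩ := exists_isMaxWt (fun i : D => (i : E) - O) η (fun i => hη _ i.2) (b - O)
    (Pi.single ⟨b, hb⟩ 1) (hsn _) hsingle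
  have htot := hw.2.2 _ (hsn _) hsingle
  rw [Finset.sum_pi_single'] at htot
  simp only [Finset.mem_univ, if_true] at htot
  have hvis : ∀ c : D, w c ≠ 0 → Vis D O c := by
    intro c hc t ht0 ht1 hmem
    obtain ⟨v, hv0, hv1, hv⟩ := base_wt D O _ hmem
    rw [add_sub_cancel_left] at hv
    have htpos : 0 < t := by
      rcases ht0.lt_or_eq with h | h
      · exact h
      · exfalso
        have h1 := congrArg η hv
        rw [← h, zero_smul, map_zero, map_sum] at h1
        have : ∑ i : D, v i ≤ ∑ i : D, η (v i • ((i : E) - O)) := by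
          refine Finset.sum_le_sum fun i _ => ?_
          rw [map_smul, smul_eq_mul]
          exact le_mul_of_one_le_right (hv0 i) (hη _ i.2)
        linarith
    have := hw.dir (fun i => t⁻¹ * v i - (Pi.single c (1 : ℝ) : D → ℝ) i) ?_ ?_
    · rw [Finset.sum_sub_distrib, ← Finset.mul_sum, hv1] at this
      have h2 : 1 < t⁻¹ := (one_lt_inv₀ htpos).2 ht1
      have h3 : ∑ i, (Pi.single c (1 : ℝ) : D → ℝ) i = 1 := by simp
      linarith
    · simp only [sub_smul, mul_smul, Finset.sum_sub_distrib, ← Finset.smul_sum, hv]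
      rw [inv_smul_smul₀ htpos.ne', Finset.sum_eq_single c]
      · simp
      · intro d _ hd; simp [hd]
      · simp
    · intro i hi
      have : i ≠ c := fun h => hc (h ▸ hi)
      simp only [Pi.single_eq_of_ne this, sub_zero]
      exact mul_nonneg (inv_nonneg.2 ht0) (hv0 i)
  have h1 := congrArg ξ hw.2.1
  rw [map_sum, map_sub] at h1
  have h2 : ∑ i : D, ξ (w i • ((i : E) - O)) ≤ ∑ i : D, - w i := by
    refine Finset.sum_le_sum fun i _ => ?_
    rw [map_smul, smul_eq_mul, map_sub]
    by_cases hi : w i = 0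
    · simp [hi]
    · have := hξ _ i.2 (hvis i hi)
      nlinarith [hw.1 i]
  rw [Finset.sum_neg_distrib] at h2
  linarith

theorem coverage (D : Finset E) (O : E) (η : E →ₗ[ℝ] ℝ) (hη : ∀ b ∈ D, 1 ≤ η (b - O))
    (x : E) (hx : x ∈ convexHull ℝ (insert O (D : Set E))) (hx' : x ∉ convexHull ℝ (D : Set E))
    (hgen : ∀ T ⊆ D, x - O ∈ Submodule.span ℝ ((fun b => b - O) '' (T : Set E)) →
      Submodule.span ℝ ((fun b => b - O) '' (T : Set E)) = ⊤) :
    ∃ ξ : E →ₗ[ℝ] ℝ, (∀ b ∈ D, ξ b ≤ ξ O - 1) ∧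
      Submodule.span ℝ ((fun b => b - O) '' {b | b ∈ D ∧ ξ b = ξ O - 1}) = ⊤ ∧
      x ∈ convexHull ℝ (insert O {b | b ∈ D ∧ ξ b = ξ O - 1}) := by
  obtain ⟨w0, h0, h01, h0x⟩ := pyr_wt D O x hx
  obtain ⟨w, hw⟩ := exists_isMaxWt (fun i : D => (i : E) - O) η (fun i => hη _ i.2) (x - O) w0 h0 h0x
  have hle : ∑ i, w i ≤ 1 := by
    by_contra hcon
    push Not at hcon
    apply hx'
    set s0 := ∑ i, w0 i with hs0
    set s := ∑ i, w i with hs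
    have hpos : 0 < s - s0 := by linarith
    refine base_mem D O (fun i => ((1 - s0) / (s - s0)) * w i + ((s - 1) / (s - s0)) * w0 i) ?_ ?_ x ?_
    · intro i
      have := hw.1 i
      have := h0 i
      have : 0 ≤ 1 - s0 := by linarith
      have : 0 ≤ s - 1 := by linarith
      have := hpos.le
      positivity
    · rw [Finset.sum_add_distrib, ← Finset.mul_sum, ← Finset.mul_sum, ← hs, ← hs0]
      field_simp
      ring
    · have hw1 := hw.2.1
      simp only [add_smul, mul_smul, Finset.sum_add_distrib, ← Finset.smul_sum, h0x, hw1]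
      rw [← add_smul, ← add_div]
      have : (1 - s0 + (s - 1)) / (s - s0) = 1 := by
        rw [div_eq_one_iff_eq hpos.ne']; ring
      rw [this, one_smul]
  have himg : (fun i : D => (i : E) - O) '' {i | w i ≠ 0} =
      (fun b => b - O) '' (((Finset.univ.filter fun i : D => w i ≠ 0).map ⟨Subtype.val, Subtype.val_injective⟩ : Finset E) : Set E) := by
    ext y
    simp
  have hsp : Submodule.span ℝ ((fun i : D => (i : E) - O) '' {i | w i ≠ 0}) = ⊤ := by
    rw [himg]
    apply hgen
    · intro b hb
      simp only [Finset.mem_map, Finset.mem_filter] at hb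
      obtain ⟨i, -, rfl⟩ := hb
      exact i.2
    · rw [← himg, ← hw.2.1]
      refine Submodule.sum_mem _ fun i _ => ?_
      by_cases hi : w i = 0
      · simp [hi]
      · exact Submodule.smul_mem _ _ (Submodule.subset_span ⟨i, hi, rfl⟩)
  obtain ⟨ζ, hζ1, hζ2⟩ := hw.dual hsp
  refine ⟨-ζ, ?_, ?_, ?_⟩
  · intro b hb
    have := hζ1 ⟨b, hb⟩
    simp only [map_sub] at this
    simp only [LinearMap.neg_apply]
    linarith
  · rw [eq_top_iff, ← hsp]
    apply Submodule.span_mono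
    rintro _ ⟨i, hi, rfl⟩
    refine ⟨i, ⟨i.2, ?_⟩, rfl⟩
    have := hζ2 i hi
    simp only [map_sub] at this
    simp only [LinearMap.neg_apply]
    linarith
  · refine wt_mem _ (convex_convexHull ℝ _) O (subset_convexHull ℝ _ (Set.mem_insert _ _))
      (fun i : D => (i : E)) w hw.1 ?_ hle x hw.2.1
    intro i hi
    refine subset_convexHull ℝ _ (Set.mem_insert_of_mem _ ⟨i.2, ?_⟩)
    have := hζ2 i hi
    simp only [map_sub] at this
    simp only [LinearMap.neg_apply]
    linarith

end Geo

section Meas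
open MeasureTheory

theorem null_translate {E : Type*} [NormedAddCommGroup E] [NormedSpace ℝ E] [FiniteDimensional ℝ E]
    [MeasurableSpace E] [BorelSpace E] (μ : Measure E) [μ.IsAddHaarMeasure]
    (p : Submodule ℝ E) (hp : p ≠ ⊤) (x0 : E) : μ {x | x - x0 ∈ p} = 0 := by
  have h : {x | x - x0 ∈ p} = (fun x => x + -x0) ⁻¹' (p : Set E) := by
    ext x; simp [sub_eq_add_neg]
  rw [h, measure_preimage_add_right]
  exact Measure.addHaar_submodule μ p hp

theorem null_hyper {E : Type*} [NormedAddCommGroup E] [NormedSpace ℝ E] [FiniteDimensional ℝ E]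
    [MeasurableSpace E] [BorelSpace E] (μ : Measure E) [μ.IsAddHaarMeasure]
    (f : E →ₗ[ℝ] ℝ) (hf : f ≠ 0) (c : ℝ) : μ {x | f x = c} = 0 := by
  rcases Set.eq_empty_or_nonempty {x | f x = c} with h | ⟨x0, hx0⟩
  · rw [h]; simp
  · have h1 := null_translate μ (LinearMap.ker f) (by rwa [Ne, LinearMap.ker_eq_top]) x0
    convert h1 using 2
    ext x
    have : f x0 = c := hx0
    simp [sub_eq_zero, this]

/-- the set of functionals indexing the full-dimensional cells -/
def cellFun {E : Type*} [AddCommGroup E] [Module ℝ E] (D : Finset E) (O : E) :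
    Set (E →ₗ[ℝ] ℝ) :=
  {ξ | (∀ b ∈ D, ξ b ≤ ξ O - 1) ∧
      Submodule.span ℝ ((fun b => b - O) '' {b | b ∈ D ∧ ξ b = ξ O - 1}) = ⊤}

theorem cellFun_finite {E : Type*} [AddCommGroup E] [Module ℝ E] (D : Finset E) (O : E) :
    (cellFun D O).Finite := by
  refine Set.Finite.of_finite_image (f := fun ξ : E →ₗ[ℝ] ℝ => D.filter fun b => ξ b = ξ O - 1)
    (D.powerset.finite_toSet.subset ?_) ?_
  · rintro _ ⟨ξ, -, rfl⟩
    exact Finset.mem_coe.2 (Finset.mem_powerset.2 (Finset.filter_subset _ _))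
  · intro ξ hξ ξ' hξ' heq
    refine LinearMap.ext_on hξ.2 ?_
    rintro _ ⟨b, ⟨hb, hb'⟩, rfl⟩
    have h1 : b ∈ D.filter fun b => ξ' b = ξ' O - 1 := by
      have h2 : b ∈ D.filter fun b => ξ b = ξ O - 1 := Finset.mem_filter.2 ⟨hb, hb'⟩
      have heq' : (D.filter fun b => ξ b = ξ O - 1) = D.filter fun b => ξ' b = ξ' O - 1 := heq
      rwa [heq'] at h2
    have h3 := (Finset.mem_filter.1 h1).2
    simp only [map_sub]
    linarith

theorem measure_decomp {E : Type*} [NormedAddCommGroup E] [NormedSpace ℝ E] [FiniteDimensional ℝ E]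
    [MeasurableSpace E] [BorelSpace E] (μ : Measure E) [μ.IsAddHaarMeasure]
    (D : Finset E) (O : E) (η : E →ₗ[ℝ] ℝ) (hη : ∀ b ∈ D, 1 ≤ η (b - O)) :
    μ.real (convexHull ℝ (insert O (D : Set E))) = μ.real (convexHull ℝ (D : Set E)) +
      ∑ ξ ∈ (cellFun_finite D O).toFinset,
        μ.real (convexHull ℝ (insert O {b | b ∈ D ∧ ξ b = ξ O - 1})) := by
  set F := (cellFun_finite D O).toFinset with hF
  set C : (E →ₗ[ℝ] ℝ) → Set E := fun ξ => convexHull ℝ (insert O {b | b ∈ D ∧ ξ b = ξ O - 1}) with hC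
  have hfinT : ∀ ξ : E →ₗ[ℝ] ℝ, (insert O {b | b ∈ D ∧ ξ b = ξ O - 1}).Finite := fun ξ =>
    (D.finite_toSet.subset fun b hb => hb.1).insert O
  have hCc : ∀ ξ, IsCompact (C ξ) := fun ξ => Set.Finite.isCompact_convexHull (𝕜 := ℝ) (hfinT ξ)
  have hDc : IsCompact (convexHull ℝ (D : Set E)) :=
    Set.Finite.isCompact_convexHull (𝕜 := ℝ) D.finite_toSet
  have hmemF : ∀ ξ ∈ F, ξ ∈ cellFun D O := fun ξ hξ => by simpa [hF] using hξ
  have hCle : ∀ ξ, ∀ x ∈ C ξ, ξ O - 1 ≤ ξ x := by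
    intro ξ x hx
    have := linfun_le_on_hull (-ξ) (-(ξ O - 1)) _ ?_ x hx
    · simp only [LinearMap.neg_apply] at this; linarith
    · rintro d (rfl | hd)
      · simp
      · simp [hd.2]
  have hdisj1 : ∀ ξ ∈ F, AEDisjoint μ (convexHull ℝ (D : Set E)) (C ξ) := by
    intro ξ hξ
    have hξ' := hmemF ξ hξ
    by_cases hne : (D : Set E).Nonempty
    · obtain ⟨b, hb⟩ := hne
      refine measure_mono_null ?_ (null_hyper μ ξ ?_ (ξ O - 1))
      · rintro x ⟨hx1, hx2⟩
        exact le_antisymm (linfun_le_on_hull ξ _ _ hξ'.1 x hx1) (hCle ξ x hx2)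
      · rintro rfl
        have := hξ'.1 b hb
        simp at this
        linarith
    · rw [Set.not_nonempty_iff_eq_empty] at hne
      rw [hne, convexHull_empty]
      simp [AEDisjoint]
  have hcmp : ∀ ξ ξ' : E →ₗ[ℝ] ℝ, (∀ b ∈ D, ξ' b ≤ ξ' O - 1) → ∀ x ∈ C ξ, (ξ' - ξ) x ≤ (ξ' - ξ) O := by
    intro ξ ξ' h' x hx
    refine linfun_le_on_hull (ξ' - ξ) _ _ ?_ x hx
    rintro d (rfl | hd)
    · exact le_rfl
    · have := h' d hd.1
      simp only [LinearMap.sub_apply, hd.2]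
      linarith
  have hdisj2 : Set.Pairwise (F : Set (E →ₗ[ℝ] ℝ)) (Function.onFun (AEDisjoint μ) C) := by
    intro ξ hξ ξ' hξ' hne
    refine measure_mono_null ?_ (null_hyper μ (ξ' - ξ) (sub_ne_zero.2 hne.symm) ((ξ' - ξ) O))
    rintro x ⟨hx1, hx2⟩
    have h1 := hcmp ξ ξ' (hmemF ξ' hξ').1 x hx1
    have h2 := hcmp ξ' ξ (hmemF ξ hξ).1 x hx2
    simp only [LinearMap.sub_apply] at h1 h2
    change (ξ' - ξ) x = (ξ' - ξ) O
    simp only [LinearMap.sub_apply]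
    linarith
  let N : Set E := ⋃ T ∈ D.powerset.filter fun T : Finset E =>
    Submodule.span ℝ ((fun b => b - O) '' (T : Set E)) ≠ ⊤,
    {x | x - O ∈ Submodule.span ℝ ((fun b => b - O) '' (T : Set E))}
  have hN : μ N = 0 := by
    refine (measure_biUnion_null_iff (Finset.countable_toSet _)).2 ?_
    intro T hT
    have hT' := (Finset.mem_filter.1 hT).2
    exact null_translate μ _ hT' O
  have hcover : convexHull ℝ (insert O (D : Set E)) ⊆
      (convexHull ℝ (D : Set E) ∪ ⋃ ξ ∈ F, C ξ) ∪ N := by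
    intro x hx
    by_cases hxD : x ∈ convexHull ℝ (D : Set E)
    · exact Or.inl (Or.inl hxD)
    by_cases hxN : x ∈ N
    · exact Or.inr hxN
    obtain ⟨ξ, h1, h2, h3⟩ := coverage D O η hη x hx hxD (by
      intro T hT hxT
      by_contra hne
      apply hxN
      simp only [N, Set.mem_iUnion]
      exact ⟨T, Finset.mem_filter.2 ⟨Finset.mem_powerset.2 hT, hne⟩, hxT⟩)
    refine Or.inl (Or.inr ?_)
    simp only [Set.mem_iUnion]
    exact ⟨ξ, by simp only [hF, Set.Finite.mem_toFinset]; exact ⟨h1, h2⟩, h3⟩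
  have hsub : (convexHull ℝ (D : Set E) ∪ ⋃ ξ ∈ F, C ξ) ⊆ convexHull ℝ (insert O (D : Set E)) := by
    refine Set.union_subset (convexHull_mono (Set.subset_insert _ _)) ?_
    refine Set.iUnion₂_subset fun ξ _ => convexHull_mono ?_
    exact Set.insert_subset_insert fun b hb => hb.1
  have hmain : μ (convexHull ℝ (insert O (D : Set E))) =
      μ (convexHull ℝ (D : Set E)) + ∑ ξ ∈ F, μ (C ξ) := by
    rw [← measure_biUnion_finset₀ hdisj2 fun ξ _ => (hCc ξ).measurableSet.nullMeasurableSet,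
      ← measure_union₀]
    · apply le_antisymm
      · refine (measure_mono hcover).trans ((measure_union_le _ _).trans ?_)
        rw [hN, add_zero]
      · exact measure_mono hsub
    · exact (Finset.measurableSet_biUnion F fun ξ _ => (hCc ξ).measurableSet).nullMeasurableSet
    · refine measure_mono_null (t := ⋃ ξ ∈ F, (convexHull ℝ (D : Set E) ∩ C ξ)) ?_ ?_
      · rw [Set.inter_iUnion₂]
      · refine (measure_biUnion_null_iff (Finset.countable_toSet _)).2 ?_
        exact hdisj1
  rw [measureReal_def, hmain, ENNReal.toReal_add hDc.measure_lt_top.ne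
    (ENNReal.sum_ne_top.2 fun ξ _ => (hCc ξ).measure_lt_top.ne),
    ENNReal.toReal_sum fun ξ _ => (hCc ξ).measure_lt_top.ne]
  rfl

theorem latVol_decomp {k : ℕ} {E : Type*} [AddCommGroup E] [Module ℝ E] (L : AddSubgroup E)
    (e : E ≃ₗ[ℝ] (Fin k → ℝ)) (he : ∀ x, x ∈ L ↔ e x ∈ intLattice k)
    (D : Finset E) (O : E) (η : E →ₗ[ℝ] ℝ) (hη : ∀ b ∈ D, 1 ≤ η (b - O)) :
    latVol L k (convexHull ℝ (insert O (D : Set E))) = latVol L k (convexHull ℝ (D : Set E)) +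
      ∑ ξ ∈ (cellFun_finite D O).toFinset,
        latVol L k (convexHull ℝ (insert O {b | b ∈ D ∧ ξ b = ξ O - 1})) := by
  let : NormedAddCommGroup E := NormedAddCommGroup.induced E (Fin k → ℝ) e e.injective
  let : NormedSpace ℝ E := NormedSpace.induced ℝ E (Fin k → ℝ) e
  let : MeasurableSpace E := borel E
  have : BorelSpace E := ⟨rfl⟩
  have : FiniteDimensional ℝ E := LinearEquiv.finiteDimensional e.symm
  let eL : E ≃L[ℝ] (Fin k → ℝ) := e.toContinuousLinearEquiv
  let μ : Measure E := Measure.map eL.symm volume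
  have hμH : μ.IsAddHaarMeasure := eL.symm.isAddHaarMeasure_map volume
  have hμ : ∀ T : Set E, T.Finite → latVol L k (convexHull ℝ T) = k.factorial * μ.real (convexHull ℝ T) := by
    intro T hT
    rw [latVol_eq_volume L e he T hT]
    congr 1
    have himg : convexHull ℝ (e '' T) = e '' convexHull ℝ T :=
      (LinearMap.image_convexHull e.toLinearMap T).symm
    have h2 : μ (convexHull ℝ T) = volume (eL.symm ⁻¹' convexHull ℝ T) :=
      (eL.symm.toHomeomorph.toMeasurableEquiv).map_apply _
    rw [himg, measureReal_def, measureReal_def, h2]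
    congr 2
    ext y
    simp only [Set.mem_image, Set.mem_preimage]
    constructor
    · rintro ⟨x, hx, rfl⟩
      have : eL.symm (e x) = x := e.symm_apply_apply x
      rwa [this]
    · intro h
      exact ⟨_, h, e.apply_symm_apply y⟩
  rw [hμ _ (D.finite_toSet.insert O), hμ _ D.finite_toSet, measure_decomp μ D O η hη, mul_add,
    Finset.mul_sum]
  congr 1
  refine Finset.sum_congr rfl fun ξ _ => ?_
  rw [hμ _ ((D.finite_toSet.subset fun b hb => hb.1).insert O)]

theorem latVol_null {k : ℕ} {E : Type*} [AddCommGroup E] [Module ℝ E] (L : AddSubgroup E)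
    (e : E ≃ₗ[ℝ] (Fin k → ℝ)) (he : ∀ x, x ∈ L ↔ e x ∈ intLattice k)
    (T : Set E) (hT : T.Finite) (p : Submodule ℝ E) (hp : p ≠ ⊤) (x0 : E)
    (h : ∀ d ∈ T, d - x0 ∈ p) : latVol L k (convexHull ℝ T) = 0 := by
  rw [latVol_eq_volume L e he T hT, measureReal_def]
  have hne : p.map e.toLinearMap ≠ ⊤ := by
    intro h
    apply hp
    rw [eq_top_iff]
    intro x _
    have : e x ∈ p.map e.toLinearMap := by rw [h]; trivial
    obtain ⟨y, hy, hyx⟩ := this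
    have : y = x := e.injective hyx
    exact this ▸ hy
  have : volume (convexHull ℝ (e '' T)) = 0 := by
    refine measure_mono_null ?_ (null_translate volume (p.map e.toLinearMap) hne (e x0))
    refine convexHull_min ?_ ?_
    · rintro _ ⟨d, hd, rfl⟩
      exact ⟨d - x0, h d hd, by simp⟩
    · intro x hx y hy a b ha hb hab
      have : a • x + b • y - e x0 = a • (x - e x0) + b • (y - e x0) := by
        have h1 : e x0 = a • e x0 + b • e x0 := by rw [← add_smul, hab, one_smul]
        nth_rw 1 [h1]
        simp only [smul_sub]; abel
      change a • x + b • y - e x0 ∈ p.map e.toLinearMap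
      rw [this]
      exact Submodule.add_mem _ (Submodule.smul_mem _ _ hx) (Submodule.smul_mem _ _ hy)
  rw [this]; simp

end Meas

theorem slice_eq {E : Type*} [AddCommGroup E] [Module ℝ E] (ξ : E →ₗ[ℝ] ℝ) (BS : Set E) (O : E)
    (c : ℝ) (h1 : ∀ a ∈ BS \ {O}, ξ a ≤ c) (h2 : ξ O - 1 ≤ c)
    (h3 : (∃ a ∈ BS \ {O}, ξ a = c) ∨ ξ O - 1 = c) :
    supFaceSlice ξ (tildeP BS O) =
      convexHull ℝ ({a | a ∈ BS \ {O} ∧ ξ a = c} ∪ {a | a = O ∧ ξ O - 1 = c}) := by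
  set G : Set (E × ℝ) :=
    {p : E × ℝ | p.1 ∈ BS \ {O} ∧ p.2 ≤ 0} ∪ {p : E × ℝ | p.1 = O ∧ p.2 ≤ -1} with hG
  let f : (E × ℝ) →ₗ[ℝ] ℝ := ξ.coprod LinearMap.id
  have hf : ∀ x : E × ℝ, f x = ξ x.1 + x.2 := fun x => by simp [f]
  have hle : ∀ g ∈ G, f g ≤ c := by
    rintro g (⟨hg, hg2⟩ | ⟨hg, hg2⟩)
    · rw [hf]; linarith [h1 _ hg]
    · rw [hf, hg]; linarith
  have hatt : ∃ g ∈ G, f g = c := by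
    rcases h3 with ⟨a, ha, hac⟩ | h
    · exact ⟨(a, 0), Or.inl ⟨ha, le_rfl⟩, by simp [hf, hac]⟩
    · exact ⟨(O, -1), Or.inr ⟨rfl, le_rfl⟩, by rw [hf]; simp only; linarith⟩
  have hface : {x ∈ tildeP BS O | ∀ y ∈ tildeP BS O, ξ y.1 + y.2 ≤ ξ x.1 + x.2} =
      {x ∈ convexHull ℝ G | f x = c} := by
    have hle' := linfun_le_on_hull f c G hle
    ext x
    constructor
    · rintro ⟨hx, hmax⟩
      refine ⟨hx, le_antisymm (hle' x hx) ?_⟩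
      obtain ⟨g, hg, hgc⟩ := hatt
      rw [← hgc, hf, hf]
      exact hmax g (subset_convexHull ℝ _ hg)
    · rintro ⟨hx, hxc⟩
      refine ⟨hx, fun y hy => ?_⟩
      rw [← hf, ← hf, hxc]
      exact hle' y hy
  rw [supFaceSlice, hface, face_hull f c G hle]
  have himg := LinearMap.image_convexHull (LinearMap.fst ℝ E ℝ) {x ∈ G | f x = c}
  have hfst : (Prod.fst : E × ℝ → E) = LinearMap.fst ℝ E ℝ := rfl
  rw [hfst, himg]
  congr 1
  ext a
  constructor
  · rintro ⟨g, ⟨hg, hgc⟩, rfl⟩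
    rw [hf] at hgc
    rcases hg with ⟨hg, hg2⟩ | ⟨hg, hg2⟩
    · exact Or.inl ⟨hg, le_antisymm (h1 _ hg) (by simp only [LinearMap.fst_apply]; linarith)⟩
    · rw [hg] at hgc
      exact Or.inr ⟨hg, le_antisymm h2 (by linarith)⟩
  · rintro (⟨ha, hac⟩ | ⟨rfl, hac⟩)
    · exact ⟨(a, 0), ⟨Or.inl ⟨ha, le_rfl⟩, by simp [hf, hac]⟩, rfl⟩
    · exact ⟨(a, -1), ⟨Or.inr ⟨rfl, le_rfl⟩, by rw [hf]; simp only; linarith⟩, rfl⟩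

theorem abs_main {k : ℕ} {E : Type*} [AddCommGroup E] [Module ℝ E] (L : AddSubgroup E)
    (e : E ≃ₗ[ℝ] (Fin k → ℝ)) (he : ∀ x, x ∈ L ↔ e x ∈ intLattice k)
    (D : Finset E) (O : E) (η : E →ₗ[ℝ] ℝ) (hη : ∀ b ∈ D, 1 ≤ η (b - O))
    (BS : Set E) (hBS : BS \ {O} ⊆ (D : Set E)) (hvis : ∀ b ∈ D, Vis D O b → b ∈ BS) :
    (∑ᶠ ξ ∈ {ξ : E →ₗ[ℝ] ℝ | {x ∈ convexHull ℝ (insert O (D : Set E)) |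
        ∀ y ∈ convexHull ℝ (insert O (D : Set E)), ξ y ≤ ξ x} = {O}},
      latVol L k (supFaceSlice ξ (tildeP BS O))) =
    latVol L k (convexHull ℝ (insert O (D : Set E))) - latVol L k (convexHull ℝ (D : Set E)) := by
  have hOD : ∀ b ∈ D, b ≠ O := by
    rintro b hb rfl
    have := hη b hb
    simp at this
    linarith
  have hcell : ∀ ξ : E →ₗ[ℝ] ℝ, (∀ b ∈ D, ξ b ≤ ξ O - 1) →
      supFaceSlice ξ (tildeP BS O) = convexHull ℝ (insert O {b | b ∈ D ∧ ξ b = ξ O - 1}) := by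
    intro ξ hξ
    rw [slice_eq ξ BS O (ξ O - 1) (fun a ha => hξ a (hBS ha)) le_rfl (Or.inr rfl)]
    congr 1
    ext a
    constructor
    · rintro (⟨ha, hac⟩ | ⟨rfl, -⟩)
      · exact Or.inr ⟨hBS ha, hac⟩
      · exact Or.inl rfl
    · rintro (rfl | ⟨ha, hac⟩)
      · exact Or.inr ⟨rfl, rfl⟩
      · exact Or.inl ⟨⟨hvis a ha (vis_of_tight D O ξ hξ a hac), hOD a ha⟩, hac⟩
  rw [latVol_decomp L e he D O η hη, add_sub_cancel_left]
  rw [finsum_mem_inter_support_eq' _ _ ((cellFun_finite D O).toFinset : Set (E →ₗ[ℝ] ℝ)),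
    finsum_mem_coe_finset]
  · refine Finset.sum_congr rfl fun ξ hξ => ?_
    rw [hcell ξ ((cellFun_finite D O).mem_toFinset.1 hξ).1]
  · intro ξ hsupp
    rw [Finset.mem_coe, Set.Finite.mem_toFinset]
    constructor
    · intro hX
      have hX' : {x ∈ convexHull ℝ (insert O (D : Set E)) |
        ∀ y ∈ convexHull ℝ (insert O (D : Set E)), ξ y ≤ ξ x} = {O} := hX
      by_cases hM : ∀ b ∈ D, ξ b ≤ ξ O - 1
      · refine ⟨hM, ?_⟩
        by_contra hne
        apply hsupp
        change latVol L k (supFaceSlice ξ (tildeP BS O)) = 0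
        rw [hcell ξ hM]
        refine latVol_null L e he _ ((D.finite_toSet.subset fun b hb => hb.1).insert O) _ hne O ?_
        rintro d (rfl | hd)
        · simp
        · exact Submodule.subset_span ⟨d, hd, rfl⟩
      · exfalso
        apply hsupp
        change latVol L k (supFaceSlice ξ (tildeP BS O)) = 0
        have hM' : ∃ b ∈ D, Vis D O b ∧ ξ O - 1 < ξ b := by
          by_contra hcon
          push Not at hcon
          exact hM (bound_of_vis D O η hη ξ hcon)
        obtain ⟨b, hb, hbv, hbξ⟩ := hM'
        have hbBS : b ∈ BS \ {O} := ⟨hvis b hb hbv, hOD b hb⟩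
        have hfin : (BS \ {O}).Finite := D.finite_toSet.subset hBS
        obtain ⟨a, ha, hamax⟩ := hfin.exists_maximalFor ξ _ ⟨b, hbBS⟩
        have hamax' : ∀ a' ∈ BS \ {O}, ξ a' ≤ ξ a := by
          intro a' ha'
          by_contra hcon
          push Not at hcon
          exact absurd (hamax ha' hcon.le) (not_le.2 hcon)
        have hba := hamax' b hbBS
        rw [slice_eq ξ BS O (ξ a) hamax' (by linarith) (Or.inl ⟨a, ha, rfl⟩)]
        have hξ0 : ξ ≠ 0 := by
          rintro rfl
          apply hOD b hb
          have : b ∈ ({O} : Set E) := by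
            rw [← hX']
            exact ⟨subset_convexHull ℝ _ (Or.inr hb), fun y _ => by simp⟩
          exact this
        refine latVol_null L e he _ ?_ (LinearMap.ker ξ) (by rwa [Ne, LinearMap.ker_eq_top]) a ?_
        · refine (hfin.subset fun x hx => hx.1).union ((Set.finite_singleton O).subset fun x hx => hx.1)
        · rintro d (⟨hd, hdc⟩ | ⟨rfl, hdc⟩)
          · simp [hdc]
          · exfalso; linarith
    · rintro ⟨hM, -⟩
      have hle : ∀ y ∈ convexHull ℝ (insert O (D : Set E)), ξ y ≤ ξ O := by
        refine linfun_le_on_hull ξ _ _ ?_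
        rintro d (rfl | hd)
        · exact le_rfl
        · linarith [hM d hd]
      have hf := face_hull ξ (ξ O) (insert O (D : Set E)) (fun d hd => hle d (subset_convexHull ℝ _ hd))
      have hs : {x ∈ insert O (D : Set E) | ξ x = ξ O} = {O} := by
        ext x
        constructor
        · rintro ⟨rfl | hx, hx2⟩
          · rfl
          · have := hM x hx
            exfalso; linarith
        · rintro rfl
          exact ⟨Or.inl rfl, rfl⟩
      rw [hs, convexHull_singleton] at hf
      change {x ∈ convexHull ℝ (insert O (D : Set E)) |
        ∀ y ∈ convexHull ℝ (insert O (D : Set E)), ξ y ≤ ξ x} = {O}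
      rw [← hf]
      ext x
      constructor
      · rintro ⟨hx, hmax⟩
        exact ⟨hx, le_antisymm (hle x hx) (hmax O (subset_convexHull ℝ _ (Or.inl rfl)))⟩
      · rintro ⟨hx, hxO⟩
        exact ⟨hx, fun y hy => hxO ▸ hle y hy⟩

/-- **The volumes `Vol_ℤ(P̃_S(ξ))` sum to the combinatorial coefficient.**
Let `S` be a proper face of `P = Conv A` and `O_S = π_S(S)`. Summing over all
linear functionals `ξ` on `π_S(ℝⁿ)` whose maximizing face on `π_S(P)` is
exactly `{O_S}` (only finitely many terms are nonzero),
`Σ_ξ Vol_ℤ(P̃_S(ξ)) = c_A^{A∩S} = Vol_ℤ(Conv π_S(A)) − Vol_ℤ(Conv π_S(A ∖ S))`,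
all volumes computed in `π_S(ℝⁿ)` with respect to the quotient lattice. -/
theorem sum_of_slice_volumes_eq_cCoef (n : ℕ) (A : Finset (Fin n → ℝ))
    (hlat : ∀ p ∈ A, p ∈ intLattice n)
    (P : Set (Fin n → ℝ)) (hP : P = convexHull ℝ (A : Set (Fin n → ℝ)))
    (S : Set (Fin n → ℝ)) (hS : IsFaceOf P S) (hSproper : S ≠ P)
    (O : (Fin n → ℝ) ⧸ vectorSpan ℝ S)
    (hO : (vectorSpan ℝ S).mkQ '' S = {O}) :
    (∑ᶠ ξ ∈ {ξ : ((Fin n → ℝ) ⧸ vectorSpan ℝ S) →ₗ[ℝ] ℝ |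
        {x ∈ (vectorSpan ℝ S).mkQ '' P |
          ∀ y ∈ (vectorSpan ℝ S).mkQ '' P, ξ y ≤ ξ x} = {O}},
      latVol (quotLat n (vectorSpan ℝ S)) (n - sdim S)
        (supFaceSlice ξ (tildeP (projSet n A S) O))) =
    latVol (quotLat n (vectorSpan ℝ S)) (n - sdim S)
      (convexHull ℝ ((vectorSpan ℝ S).mkQ '' (A : Set (Fin n → ℝ)))) -
    latVol (quotLat n (vectorSpan ℝ S)) (n - sdim S)
      (convexHull ℝ ((vectorSpan ℝ S).mkQ '' ((A : Set (Fin n → ℝ)) \ S))) := by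
  subst hP
  obtain ⟨f, hf⟩ := hS
  have hSne : S.Nonempty := by
    have h : O ∈ (vectorSpan ℝ S).mkQ '' S := by rw [hO]; rfl
    obtain ⟨s, hs, -⟩ := h
    exact ⟨s, hs⟩
  obtain ⟨s0, hs0⟩ := hSne
  have hs0' := hs0
  rw [hf] at hs0'
  obtain ⟨hs0P, hs0max⟩ := hs0'
  have hSeq : S = {x ∈ convexHull ℝ (A : Set (Fin n → ℝ)) | f x = f s0} := by
    rw [hf]
    ext x
    constructor
    · rintro ⟨hx, hmax⟩
      exact ⟨hx, le_antisymm (hs0max x hx) (hmax s0 hs0P)⟩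
    · rintro ⟨hx, hxe⟩
      exact ⟨hx, fun y hy => hxe ▸ hs0max y hy⟩
  have hAle : ∀ a ∈ (A : Set (Fin n → ℝ)), f a ≤ f s0 := fun a ha =>
    hs0max a (subset_convexHull ℝ _ ha)
  have hShull : S = convexHull ℝ {x ∈ (A : Set (Fin n → ℝ)) | f x = f s0} := by
    rw [hSeq, face_hull f (f s0) _ hAle]
  -- the functional descends
  have hWf : (vectorSpan ℝ S) ≤ LinearMap.ker f := by
    rw [vectorSpan, Submodule.span_le]
    rintro _ ⟨x, hx, y, hy, rfl⟩
    rw [hSeq] at hx hy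
    simp [hx.2, hy.2]
  have hOs0 : (vectorSpan ℝ S).mkQ s0 = O := by
    have : (vectorSpan ℝ S).mkQ s0 ∈ (vectorSpan ℝ S).mkQ '' S := ⟨s0, hs0, rfl⟩
    rw [hO] at this
    exact this
  let g : ((Fin n → ℝ) ⧸ (vectorSpan ℝ S)) →ₗ[ℝ] ℝ := (vectorSpan ℝ S).liftQ f hWf
  have hg : ∀ x, g ((vectorSpan ℝ S).mkQ x) = f x := fun x => by simp [g]
  -- lattice equivalence
  have hWspan : ∃ V : Set (Fin n → ℝ), (∀ v ∈ V, v ∈ intLattice n) ∧ (vectorSpan ℝ S) = Submodule.span ℝ V := by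
    refine ⟨{x ∈ (A : Set (Fin n → ℝ)) | f x = f s0} -ᵥ {x ∈ (A : Set (Fin n → ℝ)) | f x = f s0}, ?_, ?_⟩
    · rintro _ ⟨x, hx, y, hy, rfl⟩
      exact AddSubgroup.sub_mem _ (hlat x hx.1) (hlat y hy.1)
    · have h1 : vectorSpan ℝ S = vectorSpan ℝ (convexHull ℝ {x ∈ (A : Set (Fin n → ℝ)) | f x = f s0}) :=
        congrArg (vectorSpan ℝ) hShull
      refine h1.trans ?_
      rw [← direction_affineSpan, affineSpan_convexHull, direction_affineSpan, vectorSpan]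
  obtain ⟨V, hV, hWV⟩ := hWspan
  have hk : Module.finrank ℝ ((Fin n → ℝ) ⧸ (vectorSpan ℝ S)) = n - sdim S := by
    have := Submodule.finrank_quotient_add_finrank (vectorSpan ℝ S)
    rw [Module.finrank_fin_fun] at this
    change _ = n - Module.finrank ℝ (vectorSpan ℝ S)
    omega
  obtain ⟨e, he⟩ := exists_lattice_equiv hk V hV hWV
  let D : Finset ((Fin n → ℝ) ⧸ (vectorSpan ℝ S)) := (A.filter fun a => a ∉ S).image (vectorSpan ℝ S).mkQ
  have hD : (D : Set ((Fin n → ℝ) ⧸ (vectorSpan ℝ S))) = (vectorSpan ℝ S).mkQ '' ((A : Set (Fin n → ℝ)) \ S) := by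
    ext x
    simp [D, and_assoc]
  have hAS : ∀ a ∈ (A : Set (Fin n → ℝ)), a ∉ S → f a < f s0 := by
    intro a ha haS
    refine lt_of_le_of_ne (hAle a ha) fun h => haS ?_
    rw [hSeq]
    exact ⟨subset_convexHull ℝ _ ha, h⟩
  have hDlt : ∀ b ∈ D, g b < g O := by
    intro b hb
    rw [← Finset.mem_coe, hD] at hb
    obtain ⟨a, ⟨ha, haS⟩, rfl⟩ := hb
    rw [← hOs0, hg, hg]
    exact hAS a ha haS
  -- scaled functional
  obtain ⟨η, hη⟩ : ∃ η : ((Fin n → ℝ) ⧸ (vectorSpan ℝ S)) →ₗ[ℝ] ℝ, ∀ b ∈ D, 1 ≤ η (b - O) := by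
    refine ⟨(∑ b ∈ D, (g O - g b)⁻¹) • (-g), fun b hb => ?_⟩
    have hpos : ∀ c ∈ D, 0 ≤ (g O - g c)⁻¹ := fun c hc =>
      inv_nonneg.2 (sub_nonneg.2 (hDlt c hc).le)
    have h1 := Finset.single_le_sum hpos hb
    have h2 : 0 < g O - g b := sub_pos.2 (hDlt b hb)
    have h3 : ((∑ b ∈ D, (g O - g b)⁻¹) • (-g)) (b - O) = (∑ b ∈ D, (g O - g b)⁻¹) * (g O - g b) := by
      simp
      ring
    rw [h3]
    calc (1 : ℝ) = (g O - g b)⁻¹ * (g O - g b) := (inv_mul_cancel₀ h2.ne').symm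
      _ ≤ _ := mul_le_mul_of_nonneg_right h1 h2.le
  have hSA : ∃ a ∈ (A : Set (Fin n → ℝ)), a ∈ S := by
    by_contra hcon
    push Not at hcon
    have : {x ∈ (A : Set (Fin n → ℝ)) | f x = f s0} = ∅ := by
      ext x
      simp only [Set.mem_empty_iff_false, iff_false]
      rintro ⟨hx, hx2⟩
      exact absurd hx2 (hAS x hx (hcon x hx)).ne
    rw [this, convexHull_empty] at hShull
    rw [hShull] at hs0
    exact hs0
  have hSO : ∀ a ∈ S, (vectorSpan ℝ S).mkQ a = O := by
    intro a ha
    have : (vectorSpan ℝ S).mkQ a ∈ (vectorSpan ℝ S).mkQ '' S := ⟨a, ha, rfl⟩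
    rw [hO] at this
    exact this
  have hins : (vectorSpan ℝ S).mkQ '' (A : Set (Fin n → ℝ)) = insert O (D : Set ((Fin n → ℝ) ⧸ (vectorSpan ℝ S))) := by
    rw [hD]
    ext x
    constructor
    · rintro ⟨a, ha, rfl⟩
      by_cases haS : a ∈ S
      · exact Or.inl (hSO a haS)
      · exact Or.inr ⟨a, ⟨ha, haS⟩, rfl⟩
    · rintro (rfl | ⟨a, ⟨ha, -⟩, rfl⟩)
      · obtain ⟨a, ha, haS⟩ := hSA
        exact ⟨a, ha, hSO a haS⟩
      · exact ⟨a, ha, rfl⟩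
  have himgP : (vectorSpan ℝ S).mkQ '' convexHull ℝ (A : Set (Fin n → ℝ)) =
      convexHull ℝ (insert O (D : Set ((Fin n → ℝ) ⧸ (vectorSpan ℝ S)))) := by
    rw [LinearMap.image_convexHull, hins]
  have himgP' : (vectorSpan ℝ S).mkQ '' convexHull ℝ ((A : Set (Fin n → ℝ)) \ S) =
      convexHull ℝ (D : Set ((Fin n → ℝ) ⧸ (vectorSpan ℝ S))) := by
    rw [LinearMap.image_convexHull, hD]
  have hproj : projSet n A S = insert O (D : Set ((Fin n → ℝ) ⧸ (vectorSpan ℝ S))) ∩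
      closure (convexHull ℝ (insert O (D : Set ((Fin n → ℝ) ⧸ (vectorSpan ℝ S)))) \
        convexHull ℝ (D : Set ((Fin n → ℝ) ⧸ (vectorSpan ℝ S)))) := by
    rw [← himgP, ← himgP', ← hins]
    rfl
  have hmain := abs_main (quotLat n (vectorSpan ℝ S)) e he D O η hη (projSet n A S) ?_ ?_
  · rw [himgP, hins, ← hD]
    exact hmain
  · rw [hproj]
    rintro x ⟨⟨hx, -⟩, hxO⟩
    exact hx.resolve_left hxO
  · intro b hb hvis
    rw [hproj]
    refine ⟨Or.inr hb, ?_⟩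
    have hcont : Continuous fun t : ℝ => O + t • (b - O) := by fun_prop
    have htend : Tendsto (fun t : ℝ => O + t • (b - O)) (nhdsWithin 1 (Set.Iio 1)) (nhds b) := by
      have := hcont.tendsto 1
      simp only [one_smul, add_sub_cancel] at this
      exact this.mono_left nhdsWithin_le_nhds
    refine mem_closure_of_tendsto htend ?_
    have h0 : ∀ᶠ t : ℝ in nhdsWithin 1 (Set.Iio 1), 0 < t :=
      nhdsWithin_le_nhds (lt_mem_nhds one_pos)
    filter_upwards [self_mem_nhdsWithin, h0] with t ht1 ht0
    refine ⟨?_, hvis t ht0.le ht1⟩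
    have ht1' : t < 1 := ht1
    have := convex_convexHull ℝ (insert O (D : Set ((Fin n → ℝ) ⧸ (vectorSpan ℝ S))))
      (subset_convexHull ℝ _ (Set.mem_insert O _))
      (subset_convexHull ℝ _ (Set.mem_insert_of_mem O hb))
      (sub_nonneg.2 ht1'.le) ht0.le (sub_add_cancel 1 t)
    convert this using 1
    rw [sub_smul, one_smul, smul_sub]; abel


end
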